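/- Suppose det(W) ≠ 0. Then the following are equivalent: (1) for every n×n integer matrix B that is symmetric, has all diagonal entries 0 and every entry 0 or 1, if A and B have the same characteristic polynomial and J − I − A and J − I − B have the same characteristic polynomial (J the all-one matrix), then there exists a permutation matrix P with Pᵀ A P = B; (2) every matrix Q in Q_G is a permutation matrix. -/

import Mathlib

open Matrix

open Polynomial (C)

lemma dotProduct_map_C {m R : Type*} [Fintype m] [CommRing R] (M : Matrix m m R) :
    (1 : m → PowerSeries R) ⬝ᵥ M.map PowerSeries.C *ᵥ 1 = PowerSeries.C (1 ⬝ᵥ M *ᵥ 1) := by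
  simp [dotProduct, mulVec]

section GeneralizedSpectrum

variable {m R : Type*} [Fintype m] [DecidableEq m] [CommRing R]

lemma charpolyRev_neg (M : Matrix m m R) :
    (-M).charpolyRev = M.charpolyRev.comp (-Polynomial.X) := by
  rw [charpolyRev, charpolyRev, ← Polynomial.coe_compRingHom_apply, RingHom.map_det]
  congr 1
  ext i j : 2
  rcases eq_or_ne i j with rfl | hij <;> simp [*]

/-- The matrix `1 - tM` over the ring of formal power series in `t`. -/
noncomputable def oneSubX (M : Matrix m m R) : Matrix m m (PowerSeries R) :=
  1 - (PowerSeries.X : PowerSeries R) • M.map PowerSeries.C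

lemma det_oneSubX (M : Matrix m m R) :
    (oneSubX M).det = (M.charpolyRev : PowerSeries R) := by
  rw [charpolyRev, ← Polynomial.coeToPowerSeries.ringHom_apply, RingHom.map_det]
  congr 1
  ext i j : 1
  rcases eq_or_ne i j with rfl | hij
  · simp [oneSubX]
    exact mul_comm _ _
  · simp [oneSubX, hij]
    exact mul_comm _ _

lemma isUnit_det_oneSubX (M : Matrix m m R) : IsUnit (oneSubX M).det := by
  rw [det_oneSubX, PowerSeries.isUnit_iff_constantCoeff, Polynomial.constantCoeff_coe,
    Polynomial.coeff_zero_eq_eval_zero, eval_charpolyRev]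
  exact isUnit_one

lemma det_oneSubX_sub_allOnes (M : Matrix m m R) :
    (oneSubX (M - of fun _ _ => 1)).det =
      (oneSubX M).det * (1 + PowerSeries.X * (1 ⬝ᵥ (oneSubX M)⁻¹ *ᵥ 1)) := by
  have h : oneSubX (M - of fun _ _ => 1) = oneSubX M +
      vecMulVec (fun _ => PowerSeries.X) 1 := by
    ext i j : 1
    simp [oneSubX]
    ring
  rw [h, vecMulVec_eq Unit, det_add_replicateCol_mul_replicateRow (isUnit_det_oneSubX M),
    det_unique (n := Unit)]
  congr 1
  have h2 : (fun _ : m => (PowerSeries.X : PowerSeries R)) =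
      (PowerSeries.X : PowerSeries R) • 1 := by
    ext1
    simp
  rw [Matrix.add_apply, one_apply_eq, h2, Matrix.mul_assoc, ← replicateCol_mulVec,
    replicateRow_mul_replicateCol_apply, mulVec_smul, dotProduct_smul, smul_eq_mul]

/-- Multiplying the resolvent identity `(1 - tM)⁻¹ (1 - tM) = 1` by `M ^ k`. -/
lemma inv_oneSubX_mul_pow (M : Matrix m m R) (k : ℕ) :
    (oneSubX M)⁻¹ * (M ^ k).map PowerSeries.C =
      (M ^ k).map PowerSeries.C +
        (PowerSeries.X : PowerSeries R) • ((oneSubX M)⁻¹ * (M ^ (k + 1)).map PowerSeries.C) := by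
  have h : (M ^ k).map PowerSeries.C = oneSubX M * (M ^ k).map PowerSeries.C +
      (PowerSeries.X : PowerSeries R) • (M ^ (k + 1)).map PowerSeries.C := by
    rw [oneSubX, pow_succ', Matrix.map_mul, Matrix.sub_mul, Matrix.one_mul, Matrix.smul_mul,
      sub_add_cancel]
  have h2 := congrArg ((oneSubX M)⁻¹ * ·) h
  simp only [Matrix.mul_add, nonsing_inv_mul_cancel_left _ _ (isUnit_det_oneSubX M),
    Matrix.mul_smul] at h2
  exact h2

/-- The generating functions of walks determine the numbers of walks. -/
lemma walkCount_eq_of_resolvent {A B : Matrix m m R}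
    (h : (1 : m → PowerSeries R) ⬝ᵥ (oneSubX A)⁻¹ *ᵥ 1 = 1 ⬝ᵥ (oneSubX B)⁻¹ *ᵥ 1) (k : ℕ) :
    (1 : m → R) ⬝ᵥ A ^ k *ᵥ 1 = 1 ⬝ᵥ B ^ k *ᵥ 1 := by
  have step (M : Matrix m m R) (k : ℕ) :
      (1 : m → PowerSeries R) ⬝ᵥ ((oneSubX M)⁻¹ * (M ^ k).map PowerSeries.C) *ᵥ 1 =
        PowerSeries.C (1 ⬝ᵥ M ^ k *ᵥ 1) + PowerSeries.X *
          (1 ⬝ᵥ ((oneSubX M)⁻¹ * (M ^ (k + 1)).map PowerSeries.C) *ᵥ 1) := by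
    rw [inv_oneSubX_mul_pow, add_mulVec, dotProduct_add, dotProduct_map_C, smul_mulVec,
      dotProduct_smul, smul_eq_mul]
  have count (k : ℕ)
      (hk : (1 : m → PowerSeries R) ⬝ᵥ ((oneSubX A)⁻¹ * (A ^ k).map PowerSeries.C) *ᵥ 1 =
        1 ⬝ᵥ ((oneSubX B)⁻¹ * (B ^ k).map PowerSeries.C) *ᵥ 1) :
      (1 : m → R) ⬝ᵥ A ^ k *ᵥ 1 = 1 ⬝ᵥ B ^ k *ᵥ 1 := by
    rw [step A, step B] at hk
    simpa using congrArg PowerSeries.constantCoeff hk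
  refine count k ?_
  induction k with
  | zero => simpa using h
  | succ k ih =>
    have hc := count k ih
    rw [step A, step B, hc] at ih
    exact PowerSeries.X_mul_cancel (add_left_cancel ih)

theorem walkCount_eq_of_charpoly {A B : Matrix m m R} (h : A.charpoly = B.charpoly)
    (hc : ((of fun _ _ => (1 : R)) - 1 - A).charpoly =
      ((of fun _ _ => (1 : R)) - 1 - B).charpoly) (k : ℕ) :
    (1 : m → R) ⬝ᵥ A ^ k *ᵥ 1 = 1 ⬝ᵥ B ^ k *ᵥ 1 := by
  have shift (M : Matrix m m R) : -(M - of fun _ _ => (1 : R)) =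
      (of fun _ _ => (1 : R)) - 1 - M - scalar m (-1) := by
    rw [map_neg, map_one]
    abel
  have hneg (M : Matrix m m R) : (M - of fun _ _ => (1 : R)).charpolyRev =
      (((of fun _ _ => (1 : R)) - 1 - M).charpoly.comp
        (Polynomial.X + C (-1))).reverse.comp (-Polynomial.X) := by
    rw [← charpoly_sub_scalar, ← shift, reverse_charpoly, ← charpolyRev_neg, neg_neg]
  have hdet : (oneSubX A).det = (oneSubX B).det := by
    rw [det_oneSubX, det_oneSubX, ← reverse_charpoly, ← reverse_charpoly, h]
  have hdet' := det_oneSubX_sub_allOnes A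
  rw [det_oneSubX, hneg, hc, ← hneg, ← det_oneSubX, det_oneSubX_sub_allOnes, hdet] at hdet'
  exact (walkCount_eq_of_resolvent (PowerSeries.X_mul_cancel
    (add_left_cancel ((isUnit_det_oneSubX B).mul_left_cancel hdet'))).symm k)

end GeneralizedSpectrum

section WalkMatrix

variable {n : ℕ} {R : Type*} [CommRing R]

/-- The walk matrix `[e, Ae, …, Aⁿ⁻¹e]`. -/
def walkMatrix (A : Matrix (Fin n) (Fin n) R) : Matrix (Fin n) (Fin n) R :=
  of fun i j => (A ^ (j : ℕ) *ᵥ 1) i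

lemma col_mul_walkMatrix (M A : Matrix (Fin n) (Fin n) R) (j : Fin n) :
    (M * walkMatrix A).col j = M *ᵥ A ^ (j : ℕ) *ᵥ 1 :=
  rfl

lemma walkMatrix_map {S : Type*} [CommRing S] (f : R →+* S) (A : Matrix (Fin n) (Fin n) R) :
    walkMatrix (A.map f) = (walkMatrix A).map f := by
  ext i j
  have h := f.map_mulVec (A ^ (j : ℕ)) 1 i
  simp [walkMatrix, ← Matrix.map_pow, h]

lemma mul_walkMatrix {A B Q : Matrix (Fin n) (Fin n) R} (hQ : Q *ᵥ 1 = 1)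
    (h : A * Q = Q * B) : Q * walkMatrix B = walkMatrix A := by
  refine ext_col fun j => ?_
  have hk : SemiconjBy Q (B ^ (j : ℕ)) (A ^ (j : ℕ)) := SemiconjBy.pow_right h.symm _
  rw [col_mul_walkMatrix, mulVec_mulVec, hk.eq, ← mulVec_mulVec, hQ]
  rfl

/-- The entries of `Wᵀ W` are numbers of walks. -/
lemma walkMatrix_transpose_mulVec {A : Matrix (Fin n) (Fin n) R} (hA : Aᵀ = A) (k : ℕ)
    (j : Fin n) :
    ((walkMatrix A)ᵀ *ᵥ A ^ k *ᵥ 1) j = 1 ⬝ᵥ A ^ (j + k : ℕ) *ᵥ 1 := by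
  change (A ^ (j : ℕ) *ᵥ 1) ⬝ᵥ _ = _
  rw [pow_add, ← mulVec_mulVec, dotProduct_mulVec 1, ← mulVec_transpose, transpose_pow, hA]

variable {K : Type*} [Field K]

lemma eq_of_conj_eq {A P Q : Matrix (Fin n) (Fin n) K} (hA : (walkMatrix A).det ≠ 0)
    (hP : Pᵀ * P = 1) (hQ : Qᵀ * Q = 1) (hP1 : P *ᵥ 1 = 1) (hQ1 : Q *ᵥ 1 = 1)
    (h : Pᵀ * A * P = Qᵀ * A * Q) : P = Q := by
  have intertwine {M : Matrix (Fin n) (Fin n) K} (hM : Mᵀ * M = 1) :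
      A * M = M * (Mᵀ * A * M) := by
    rw [← Matrix.mul_assoc, ← Matrix.mul_assoc, mul_eq_one_comm.1 hM, Matrix.one_mul]
  have eP := mul_walkMatrix hP1 (intertwine hP)
  have eQ := mul_walkMatrix hQ1 (intertwine hQ)
  rw [← h, ← eP] at eQ
  rw [← eP, det_mul] at hA
  exact ((isUnit_iff_isUnit_det _).2 (right_ne_zero_of_mul hA).isUnit).mul_left_injective eQ.symm

/-- Matrices with the same numbers of walks, one of them controllable, are related by an
orthogonal matrix fixing the all-one vector. -/
lemma exists_orthogonal_conj {A B : Matrix (Fin n) (Fin n) K} (hA : (walkMatrix A).det ≠ 0)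
    (hAs : Aᵀ = A) (hBs : Bᵀ = B)
    (h : ∀ k : ℕ, (1 : Fin n → K) ⬝ᵥ A ^ k *ᵥ 1 = 1 ⬝ᵥ B ^ k *ᵥ 1) :
    ∃ Q : Matrix (Fin n) (Fin n) K, Qᵀ * Q = 1 ∧ Q *ᵥ 1 = 1 ∧ Qᵀ * A * Q = B := by
  have hU : IsUnit (walkMatrix A) := (isUnit_iff_isUnit_det _).2 hA.isUnit
  have hUT : IsUnit (walkMatrix A)ᵀ := (isUnit_transpose _).2 hU
  obtain ⟨Q, hQ⟩ : ∃ Q, (walkMatrix A)ᵀ * Q = (walkMatrix B)ᵀ :=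
    ⟨(walkMatrix A)ᵀ⁻¹ * (walkMatrix B)ᵀ, mul_nonsing_inv_cancel_left _ _
      ((isUnit_iff_isUnit_det _).1 hUT)⟩
  have hcol (k : ℕ) : Q *ᵥ B ^ k *ᵥ 1 = A ^ k *ᵥ 1 := by
    refine mulVec_injective_of_isUnit hUT ?_
    rw [mulVec_mulVec, hQ]
    ext j
    rw [walkMatrix_transpose_mulVec hBs, walkMatrix_transpose_mulVec hAs, h]
  have hQW : Q * walkMatrix B = walkMatrix A := ext_col fun j => hcol j
  have hWB : IsUnit (walkMatrix B) := by
    rw [← hQW, isUnit_iff_isUnit_det, det_mul] at hU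
    exact (isUnit_iff_isUnit_det _).2 (isUnit_of_mul_isUnit_right hU)
  have horth : Qᵀ * Q = 1 := by
    refine mul_eq_one_comm.1 (hUT.mul_right_injective ?_)
    have hQT : (walkMatrix A)ᵀ = (walkMatrix B)ᵀ * Qᵀ := by rw [← hQW, transpose_mul]
    change (walkMatrix A)ᵀ * (Q * Qᵀ) = (walkMatrix A)ᵀ * 1
    rw [← Matrix.mul_assoc, hQ, ← hQT, Matrix.mul_one]
  have hAQ : A * Q = Q * B := by
    refine hWB.mul_left_injective ?_
    change A * Q * walkMatrix B = Q * B * walkMatrix B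
    refine ext_col fun j => ?_
    rw [Matrix.mul_assoc, hQW, col_mul_walkMatrix, col_mul_walkMatrix, mulVec_mulVec,
      ← pow_succ', ← hcol, pow_succ', ← mulVec_mulVec, mulVec_mulVec]
  refine ⟨Q, horth, by simpa using hcol 0, ?_⟩
  rw [Matrix.mul_assoc, hAQ, ← Matrix.mul_assoc, horth, Matrix.one_mul]

end WalkMatrix

lemma conj_allOnes {m R : Type*} [Fintype m] [CommRing R] {Q : Matrix m m R}
    (hQ1' : Qᵀ *ᵥ 1 = 1) :
    Qᵀ * (of fun _ _ => 1) * Q = of fun _ _ => 1 := by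
  have h : (of fun _ _ => (1 : R) : Matrix m m R) = vecMulVec 1 1 := by
    ext
    simp [vecMulVec]
  rw [h, mul_vecMulVec, vecMulVec_mul, hQ1', ← mulVec_transpose, hQ1']

lemma charpoly_conj_of_orthogonal {m R : Type*} [Fintype m] [DecidableEq m] [CommRing R]
    {Q : Matrix m m R} (hQ : Qᵀ * Q = 1) (M : Matrix m m R) :
    (Qᵀ * M * Q).charpoly = M.charpoly := by
  rw [charpoly_mul_comm, ← Matrix.mul_assoc, mul_eq_one_comm.1 hQ, Matrix.one_mul]

lemma permMatrix_map_ringHom {m R S : Type*} [DecidableEq m] [CommRing R] [CommRing S]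
    (f : R →+* S) (σ : Equiv.Perm m) : (σ.permMatrix R).map f = σ.permMatrix S := by
  ext i j
  by_cases h : σ i = j <;> simp [PEquiv.toMatrix_apply, h, eq_comm]

lemma permMatrix_orthogonal {m R : Type*} [Fintype m] [DecidableEq m] [CommRing R]
    (σ : Equiv.Perm m) : (σ.permMatrix R)ᵀ * σ.permMatrix R = 1 := by
  rw [transpose_permMatrix, ← permMatrix_mul, mul_inv_cancel, permMatrix_one]

/-- For a controllable graph `G`, `G` is determined by its generalized
spectrum iff every matrix in `Q_G` is a permutation matrix. -/
theorem stmt_2 (n : ℕ) (hn : 0 < n)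
    (A : Matrix (Fin n) (Fin n) ℤ)
    (hA_symm : Aᵀ = A)
    (hA_diag : ∀ i, A i i = 0)
    (hA_01 : ∀ i j, A i j = 0 ∨ A i j = 1)
    (W : Matrix (Fin n) (Fin n) ℤ)
    (hW : W = Matrix.of fun (i j : Fin n) => (A ^ (j : ℕ)).mulVec (fun _ => (1 : ℤ)) i)
    (hdet : W.det ≠ 0) :
    (∀ B : Matrix (Fin n) (Fin n) ℤ, Bᵀ = B → (∀ i, B i i = 0) →
        (∀ i j, B i j = 0 ∨ B i j = 1) →
        A.charpoly = B.charpoly →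
        ((Matrix.of fun _ _ => (1 : ℤ)) - 1 - A).charpoly
          = ((Matrix.of fun _ _ => (1 : ℤ)) - 1 - B).charpoly →
        ∃ σ : Equiv.Perm (Fin n), (σ.permMatrix ℤ)ᵀ * A * σ.permMatrix ℤ = B)
    ↔ (∀ Q : Matrix (Fin n) (Fin n) ℚ, Qᵀ * Q = 1 →
        Q.mulVec (fun _ => (1 : ℚ)) = (fun _ => (1 : ℚ)) →
        (Qᵀ * A.map (Int.cast : ℤ → ℚ) * Q)ᵀ = Qᵀ * A.map (Int.cast : ℤ → ℚ) * Q →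
        (∀ i, (Qᵀ * A.map (Int.cast : ℤ → ℚ) * Q) i i = 0) →
        (∀ i j, (Qᵀ * A.map (Int.cast : ℤ → ℚ) * Q) i j = 0 ∨
          (Qᵀ * A.map (Int.cast : ℤ → ℚ) * Q) i j = 1) →
        ∃ σ : Equiv.Perm (Fin n), Q = σ.permMatrix ℚ) := by
  have hinj : Function.Injective (Int.castRingHom ℚ) := Int.cast_injective
  have hmap : A.map (Int.cast : ℤ → ℚ) = A.map (Int.castRingHom ℚ) := rfl
  have hdetA : (walkMatrix (A.map (Int.castRingHom ℚ))).det ≠ 0 := by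
    have hWA : W = walkMatrix A := hW
    rw [walkMatrix_map, ← RingHom.mapMatrix_apply, ← RingHom.map_det, ← hWA]
    exact (map_ne_zero_iff _ hinj).2 hdet
  have map_conj (σ : Equiv.Perm (Fin n)) :
      ((σ.permMatrix ℤ)ᵀ * A * σ.permMatrix ℤ).map (Int.castRingHom ℚ) =
        (σ.permMatrix ℚ)ᵀ * A.map (Int.castRingHom ℚ) * σ.permMatrix ℚ := by
    rw [Matrix.map_mul, Matrix.map_mul, transpose_map, permMatrix_map_ringHom]
  rw [hmap]
  constructor
  · intro h Q hQ hQ1 hsymm hdiag h01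
    have hQ1' : Qᵀ *ᵥ 1 = 1 := by
      have h1 : Q *ᵥ 1 = 1 := hQ1
      conv_lhs => rw [← h1]
      rw [mulVec_mulVec, hQ, one_mulVec]
    obtain ⟨B, hB⟩ : ∃ B : Matrix (Fin n) (Fin n) ℤ,
        B.map (Int.castRingHom ℚ) = Qᵀ * A.map (Int.castRingHom ℚ) * Q := by
      have hex (i j) : ∃ b : ℤ, (b : ℚ) = (Qᵀ * A.map (Int.castRingHom ℚ) * Q) i j := by
        rcases h01 i j with h0 | h0
        · exact ⟨0, by rw [h0, Int.cast_zero]⟩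
        · exact ⟨1, by rw [h0, Int.cast_one]⟩
      choose b hb using hex
      exact ⟨of b, Matrix.ext hb⟩
    rw [← hB] at hsymm hdiag h01
    simp only [map_apply, eq_intCast] at hdiag h01
    obtain ⟨σ, hσ⟩ := h B (map_injective hinj (transpose_map.trans hsymm))
      (fun i => by exact_mod_cast hdiag i) (fun i j => by exact_mod_cast h01 i j)
      (Polynomial.map_injective _ hinj (by
        rw [← charpoly_map, ← charpoly_map, hB, charpoly_conj_of_orthogonal hQ]))
      (Polynomial.map_injective _ hinj (by
        have hJ : (of fun _ _ => (1 : ℤ) : Matrix (Fin n) (Fin n) ℤ).map (Int.castRingHom ℚ) =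
            of fun _ _ => 1 := by ext; simp
        have hcompl (M : Matrix (Fin n) (Fin n) ℤ) :
            ((of fun _ _ => (1 : ℤ)) - 1 - M).map (Int.castRingHom ℚ) =
              (of fun _ _ => 1) - 1 - M.map (Int.castRingHom ℚ) := by
          rw [← hJ]
          simp [Matrix.map_sub]
        rw [← charpoly_map, ← charpoly_map, hcompl, hcompl, hB,
          ← charpoly_conj_of_orthogonal hQ ((of fun _ _ => 1) - 1 - A.map _), Matrix.mul_sub,
          Matrix.mul_sub, Matrix.sub_mul, Matrix.sub_mul, conj_allOnes hQ1', Matrix.mul_one,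
          hQ]))
    refine ⟨σ, eq_of_conj_eq hdetA hQ (permMatrix_orthogonal σ) hQ1 ?_ ?_⟩
    · rw [permMatrix_mulVec]
      rfl
    · rw [← hB, ← hσ, map_conj]
  · intro h B hB_symm hB_diag hB_01 hcp hcp'
    have hcount := walkCount_eq_of_charpoly hcp hcp'
    have count_map (M : Matrix (Fin n) (Fin n) ℤ) (k : ℕ) :
        (1 : Fin n → ℚ) ⬝ᵥ M.map (Int.castRingHom ℚ) ^ k *ᵥ 1 =
          Int.castRingHom ℚ (1 ⬝ᵥ M ^ k *ᵥ 1) := by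
      rw [← Matrix.map_pow]
      simp [dotProduct, mulVec]
    obtain ⟨Q, hQ, hQ1, hQAB⟩ := exists_orthogonal_conj
      (B := B.map (Int.castRingHom ℚ)) hdetA
      (by rw [← transpose_map, hA_symm]) (by rw [← transpose_map, hB_symm])
      (fun k => by rw [count_map, count_map, hcount])
    obtain ⟨σ, rfl⟩ := h Q hQ hQ1 (by rw [hQAB, ← transpose_map, hB_symm])
      (fun i => by rw [hQAB]; simp [hB_diag])
      (fun i j => by rw [hQAB]; simpa using (by exact_mod_cast hB_01 i j))
    exact ⟨σ, map_injective hinj ((map_conj σ).trans hQAB)⟩
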